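/- arXiv:2502.02595 — 16 statements merged into one kernel-verified Lean document; each statement's English description precedes it below -/
import Mathlib

section
/- Let (X,d) be a metric space with at least 3 points and let T : X → X satisfy, for some α, λ ≥ 0, the inequality d(Tx,Ty) + d(Ty,Tz) + d(Tx,Tz) ≤ α(d(x,y) + d(y,z) + d(z,x)) + λ(d(x,Tx) + d(y,Ty) + d(z,Tz)) for all three pairwise distinct points x, y, z ∈ X. If x ∈ X is an accumulation point of X and T is continuous at x, then for every y ∈ X the inequality d(Tx,Ty) ≤ α·d(x,y) + λ·(d(x,Tx) + d(y,Ty)/2) holds. -/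
open Filter Topology

/-- If T is a generalized Ćirić–Reich–Rus type mapping, x is an accumulation
point of X and T is continuous at x, then
d(Tx,Ty) ≤ α d(x,y) + λ (d(x,Tx) + d(y,Ty)/2) for all y. -/
theorem generalized_crr_two_point_ineq_at_accumulation_point
    {X : Type*} [MetricSpace X]
    (h3 : ∃ p q r : X, p ≠ q ∧ p ≠ r ∧ q ≠ r)
    (T : X → X) (α lam : ℝ) (hα : 0 ≤ α) (hlam : 0 ≤ lam)
    (hT : ∀ x y z : X, x ≠ y → y ≠ z → x ≠ z →
      dist (T x) (T y) + dist (T y) (T z) + dist (T x) (T z) ≤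
        α * (dist x y + dist y z + dist z x) +
        lam * (dist x (T x) + dist y (T y) + dist z (T z)))
    (x : X)
    (hacc : ∃ u : ℕ → X, (∀ n, u n ≠ x) ∧ Tendsto u atTop (𝓝 x))
    (hcont : ContinuousAt T x) :
    ∀ y : X,
      dist (T x) (T y) ≤ α * dist x y + lam * (dist x (T x) + dist y (T y) / 2) := by
  intro y
  obtain rfl | hxy := eq_or_ne x y
  · simp only [dist_self, mul_zero, zero_add]
    positivity
  obtain ⟨u, hux, hu⟩ := hacc
  have hTu : Tendsto (fun n => T (u n)) atTop (𝓝 (T x)) := hcont.tendsto.comp hu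
  have hL : Tendsto
      (fun n => dist (T x) (T (u n)) + dist (T (u n)) (T y) + dist (T x) (T y)) atTop
      (𝓝 (dist (T x) (T x) + dist (T x) (T y) + dist (T x) (T y))) :=
    ((tendsto_const_nhds.dist hTu).add (hTu.dist tendsto_const_nhds)).add_const _
  have hR : Tendsto
      (fun n => α * (dist x (u n) + dist (u n) y + dist y x) +
        lam * (dist x (T x) + dist (u n) (T (u n)) + dist y (T y))) atTop
      (𝓝 (α * (dist x x + dist x y + dist y x) +
        lam * (dist x (T x) + dist x (T x) + dist y (T y)))) :=
    ((((tendsto_const_nhds.dist hu).add (hu.dist tendsto_const_nhds)).add_const _).const_mul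
      α).add ((((hu.dist hTu).const_add _).add_const _).const_mul lam)
  have hle := le_of_tendsto_of_tendsto hL hR <| by
    filter_upwards [hu.eventually_ne hxy] with n hn
    exact hT x (u n) y (hux n).symm hn hxy
  rw [dist_self, dist_self, dist_comm y x] at hle
  linarith
end

section
/- Let (X,d) be a metric space with at least 3 points in which every point is an accumulation point, and let T : X → X be a continuous generalized Ćirić–Reich–Rus type mapping with coefficients α, λ ≥ 0 satisfying 2α + (3/2)λ < 1. Then T is a Ćirić–Reich–Rus type mapping with constants a = α and b = c = (3/4)λ, i.e., d(Tx,Ty) ≤ α·d(x,y) + (3λ/4)(d(x,Tx) + d(y,Ty)) for all x, y ∈ X, and these constants satisfy a + b + c < 1. -/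
open Filter Topology

/-- Letting the third point of the three-point inequality tend to `x`. -/
lemma two_mul_dist_map_le_of_tendsto
    {X : Type*} [MetricSpace X] {T : X → X} (hcont : Continuous T) {α lam : ℝ}
    (hT : ∀ x y z : X, x ≠ y → y ≠ z → x ≠ z →
      dist (T x) (T y) + dist (T y) (T z) + dist (T x) (T z) ≤
        α * (dist x y + dist y z + dist z x) +
        lam * (dist x (T x) + dist y (T y) + dist z (T z)))
    {x y : X} (hxy : x ≠ y) {u : ℕ → X} (hux : ∀ n, u n ≠ x)
    (hu : Tendsto u atTop (𝓝 x)) :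
    2 * dist (T x) (T y) ≤
      2 * α * dist x y + lam * (2 * dist x (T x) + dist y (T y)) := by
  have hTu : Tendsto (fun n => T (u n)) atTop (𝓝 (T x)) := (hcont.tendsto x).comp hu
  have key : dist (T x) (T y) + dist (T y) (T x) + dist (T x) (T x) ≤
      α * (dist x y + dist y x + dist x x) +
      lam * (dist x (T x) + dist y (T y) + dist x (T x)) := by
    refine le_of_tendsto_of_tendsto
      ((tendsto_const_nhds.add (tendsto_const_nhds.dist hTu)).add
        (tendsto_const_nhds.dist hTu))
      ((((tendsto_const_nhds.add (tendsto_const_nhds.dist hu)).add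
        (hu.dist tendsto_const_nhds)).const_mul α).add
        ((tendsto_const_nhds.add (hu.dist hTu)).const_mul lam)) ?_
    filter_upwards [hu.eventually_ne hxy] with n hn
    exact hT x y (u n) hxy hn.symm (hux n).symm
  rw [dist_self, dist_self, dist_comm (T y) (T x), dist_comm y x] at key
  linarith

/-- A continuous generalized Ćirić–Reich–Rus type mapping on a metric space in
which every point is an accumulation point is a Ćirić–Reich–Rus type mapping
with a = α, b = c = (3/4)λ, and a + b + c < 1. -/
theorem continuous_generalized_crr_is_crr
    {X : Type*} [MetricSpace X]
    (h3 : ∃ p q r : X, p ≠ q ∧ p ≠ r ∧ q ≠ r)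
    (hacc : ∀ x : X, ∃ u : ℕ → X, (∀ n, u n ≠ x) ∧ Tendsto u atTop (𝓝 x))
    (T : X → X) (hcont : Continuous T)
    (α lam : ℝ) (hα : 0 ≤ α) (hlam : 0 ≤ lam)
    (hsum : 2 * α + (3 / 2) * lam < 1)
    (hT : ∀ x y z : X, x ≠ y → y ≠ z → x ≠ z →
      dist (T x) (T y) + dist (T y) (T z) + dist (T x) (T z) ≤
        α * (dist x y + dist y z + dist z x) +
        lam * (dist x (T x) + dist y (T y) + dist z (T z))) :
    (α + (3 / 4) * lam + (3 / 4) * lam < 1) ∧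
    ∀ x y : X,
      dist (T x) (T y) ≤
        α * dist x y + (3 * lam / 4) * (dist x (T x) + dist y (T y)) := by
  refine ⟨by linarith, fun x y => ?_⟩
  rcases eq_or_ne x y with rfl | hxy
  · rw [dist_self, dist_self]
    positivity
  · obtain ⟨u, hux, hu⟩ := hacc x
    obtain ⟨v, hvy, hv⟩ := hacc y
    have h₁ := two_mul_dist_map_le_of_tendsto hcont hT hxy hux hu
    have h₂ := two_mul_dist_map_le_of_tendsto hcont hT hxy.symm hvy hv
    rw [dist_comm (T y) (T x), dist_comm y x] at h₂
    linarith
end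

section
/- Let (X,d) be a complete metric space with at least 3 points, and let T : X → X be a generalized Ćirić–Reich–Rus type mapping with coefficients α, λ ≥ 0 satisfying 2α + (3/2)λ < 1. Suppose also that T has no periodic points of prime period 2, i.e., T(T(x)) ≠ x for every x ∈ X with Tx ≠ x. Then T has a fixed point. -/
/-- For a map without points of period one or two, the contractive inequality on triples
shrinks the perimeter of the triangle `x, T x, T (T x)` along orbits. -/
theorem perimeter_orbit_contract {X : Type*} [MetricSpace X] (T : X → X) {α lam : ℝ}
    (hden : 0 < 1 - lam / 2) (hlam : 0 ≤ lam)
    (hfix : ∀ x, T x ≠ x) (hper : ∀ x, T (T x) ≠ x)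
    (hT : ∀ x y z : X, x ≠ y → y ≠ z → x ≠ z →
      dist (T x) (T y) + dist (T y) (T z) + dist (T x) (T z) ≤
        α * (dist x y + dist y z + dist z x) +
        lam * (dist x (T x) + dist y (T y) + dist z (T z))) (x : X) :
    dist (T x) (T (T x)) + dist (T (T x)) (T (T (T x))) + dist (T x) (T (T (T x))) ≤
      (α + lam) / (1 - lam / 2) *
        (dist x (T x) + dist (T x) (T (T x)) + dist x (T (T x))) := by
  have h := hT x (T x) (T (T x)) (hfix x).symm (hfix (T x)).symm (hper x).symm
  rw [dist_comm (T (T x)) x] at h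
  have htri := dist_triangle_left (T (T x)) (T (T (T x))) (T x)
  have hx : 0 ≤ dist x (T (T x)) := dist_nonneg
  rw [div_mul_eq_mul_div, le_div_iff₀ hden]
  linarith [mul_le_mul_of_nonneg_left htri hlam, mul_nonneg hlam hx]

open Filter Topology in
/-- For a map without points of period one or two, the limit of a convergent orbit is
fixed under the contractive inequality on triples. -/
theorem isFixedPt_of_tendsto_orbit {X : Type*} [MetricSpace X] (T : X → X) {α lam : ℝ}
    (hlam : lam < 2) (hfix : ∀ x, T x ≠ x) (hper : ∀ x, T (T x) ≠ x)
    (hT : ∀ x y z : X, x ≠ y → y ≠ z → x ≠ z →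
      dist (T x) (T y) + dist (T y) (T z) + dist (T x) (T z) ≤
        α * (dist x y + dist y z + dist z x) +
        lam * (dist x (T x) + dist y (T y) + dist z (T z)))
    {u : ℕ → X} (hu : ∀ n, u (n + 1) = T (u n)) {a : X} (ha : Tendsto u atTop (𝓝 a)) :
    T a = a := by
  have hgood : ∃ᶠ n in atTop, u n ≠ a ∧ u (n + 1) ≠ a := by
    rw [frequently_atTop]
    intro n
    by_cases h0 : u n = a
    · refine ⟨n + 1, by omega, ?_, ?_⟩
      · rw [hu, h0]; exact hfix a
      · rw [hu, hu, h0]; exact hper a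
    by_cases h1 : u (n + 1) = a
    · refine ⟨n + 2, by omega, ?_, ?_⟩
      · rw [hu, h1]; exact hfix a
      · rw [hu, hu, h1]; exact hper a
    exact ⟨n, le_rfl, h0, h1⟩
  have ha1 : Tendsto (fun n => u (n + 1)) atTop (𝓝 a) := ha.comp (tendsto_add_atTop_nat 1)
  have ha2 : Tendsto (fun n => u (n + 2)) atTop (𝓝 a) := ha.comp (tendsto_add_atTop_nat 2)
  have hc {b : X} : Tendsto (fun _ : ℕ => b) atTop (𝓝 b) := tendsto_const_nhds
  have hleft := ((ha1.dist ha2).add (ha2.dist (hc (b := T a)))).add (ha1.dist (hc (b := T a)))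
  have hright := ((((ha.dist ha1).add (ha1.dist (hc (b := a)))).add
    ((hc (b := a)).dist ha)).const_mul α).add
      ((((ha.dist ha1).add (ha1.dist ha2)).add
        (tendsto_const_nhds (x := dist a (T a)))).const_mul lam)
  have hle := le_of_tendsto_of_tendsto_of_frequently hleft hright <| hgood.mono fun n hn => by
    have h := hT (u n) (u (n + 1)) a (by rw [hu]; exact (hfix _).symm) hn.2 hn.1
    simpa only [← hu] using h
  simp only [dist_self] at hle
  have hnonneg : 0 ≤ dist a (T a) := dist_nonneg
  exact (dist_le_zero.mp (by nlinarith)).symm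

/-- A generalized Ćirić–Reich–Rus type mapping on a complete metric space with
at least 3 points, having no periodic points of prime period 2, has a fixed
point. -/
theorem generalized_crr_has_fixed_point
    {X : Type*} [MetricSpace X] [CompleteSpace X]
    (h3 : ∃ p q r : X, p ≠ q ∧ p ≠ r ∧ q ≠ r)
    (T : X → X) (α lam : ℝ) (hα : 0 ≤ α) (hlam : 0 ≤ lam)
    (hsum : 2 * α + (3 / 2) * lam < 1)
    (hT : ∀ x y z : X, x ≠ y → y ≠ z → x ≠ z →
      dist (T x) (T y) + dist (T y) (T z) + dist (T x) (T z) ≤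
        α * (dist x y + dist y z + dist z x) +
        lam * (dist x (T x) + dist y (T y) + dist z (T z)))
    (hper : ∀ x : X, T x ≠ x → T (T x) ≠ x) :
    ∃ x : X, T x = x := by
  obtain ⟨p, -⟩ := h3
  by_contra! hfix
  have hper' : ∀ x, T (T x) ≠ x := fun x => hper x (hfix x)
  obtain ⟨u, hu⟩ : ∃ u : ℕ → X, ∀ n, u (n + 1) = T (u n) :=
    ⟨fun n => T^[n] p, fun n => Function.iterate_succ_apply' T n p⟩
  have hden : 0 < 1 - lam / 2 := by linarith
  set k := (α + lam) / (1 - lam / 2) with hk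
  have hk0 : 0 ≤ k := by positivity
  have hk1 : k < 1 := by rw [hk, div_lt_one hden]; linarith
  set P : X → ℝ := fun x => dist x (T x) + dist (T x) (T (T x)) + dist x (T (T x)) with hP
  have hstep : ∀ x, P (T x) ≤ k * P x :=
    perimeter_orbit_contract T hden hlam hfix hper' hT
  have hgeom : ∀ n, P (u n) ≤ P (u 0) * k ^ n := by
    intro n
    induction n with
    | zero => simp
    | succ n ih =>
      rw [hu, pow_succ]
      nlinarith [hstep (u n), mul_le_mul_of_nonneg_left ih hk0]
  have hcauchy : CauchySeq u := by
    refine cauchySeq_of_le_geometric k (P (u 0)) hk1 fun n => le_trans ?_ (hgeom n)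
    rw [hu]
    simp only [hP]
    linarith [dist_nonneg (x := T (u n)) (y := T (T (u n))),
      dist_nonneg (x := u n) (y := T (T (u n)))]
  obtain ⟨a, ha⟩ := cauchySeq_tendsto_of_complete hcauchy
  exact hfix a (isFixedPt_of_tendsto_orbit T (by linarith) hfix hper' hT hu ha)
end

section
/- Let (X,d) be a metric space with at least 3 points and let T : X → X be a generalized Ćirić–Reich–Rus type mapping with coefficients α, λ ≥ 0 satisfying 2α + (3/2)λ < 1. Then T has at most two fixed points. -/
/-- A generalized Ćirić–Reich–Rus type mapping has at most two fixed points. -/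
theorem generalized_crr_at_most_two_fixed_points
    {X : Type*} [MetricSpace X]
    (h3 : ∃ p q r : X, p ≠ q ∧ p ≠ r ∧ q ≠ r)
    (T : X → X) (α lam : ℝ) (hα : 0 ≤ α) (hlam : 0 ≤ lam)
    (hsum : 2 * α + (3 / 2) * lam < 1)
    (hT : ∀ x y z : X, x ≠ y → y ≠ z → x ≠ z →
      dist (T x) (T y) + dist (T y) (T z) + dist (T x) (T z) ≤
        α * (dist x y + dist y z + dist z x) +
        lam * (dist x (T x) + dist y (T y) + dist z (T z))) :
    ∀ x y z : X, T x = x → T y = y → T z = z → x = y ∨ y = z ∨ x = z := by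
  intro x y z hx hy hz
  by_contra! h
  obtain ⟨hxy, hyz, hxz⟩ := h
  have hle := hT x y z hxy hyz hxz
  simp only [hx, hy, hz, dist_self, dist_comm z x] at hle
  have hpos := dist_pos.2 hxy
  nlinarith [dist_nonneg (x := y) (y := z), dist_nonneg (x := x) (y := z)]
end

section
/- Let (X,d) be a metric space with at least 3 points and let T : X → X be a generalized Ćirić–Reich–Rus type mapping with coefficients α, λ ≥ 0 satisfying 2α + (3/2)λ < 1, having no periodic points of prime period 2. Let x₀ ∈ X and define the iteration sequence x_{n+1} = T x_n. If none of the points x_n (n ≥ 0) is a fixed point of T, then for all n ≥ 2, d(x_{n+1}, x_{n+2}) ≤ γ · max{ d(x_{n-1}, x_n), d(x_n, x_{n+1}) }, where γ = 2(2α + λ)/(2 − λ) ∈ [0,1), and consequently (x_n) is a Cauchy sequence. -/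
/-- A sequence whose consecutive distances are bounded by `γ < 1` times the maximum of the two
preceding ones is Cauchy. -/
theorem cauchySeq_of_dist_le_mul_max {X : Type*} [PseudoMetricSpace X] {u : ℕ → X} {γ : ℝ}
    (hγ₀ : 0 ≤ γ) (hγ₁ : γ < 1)
    (hu : ∀ n, dist (u (n + 2)) (u (n + 3)) ≤
      γ * max (dist (u n) (u (n + 1))) (dist (u (n + 1)) (u (n + 2)))) :
    CauchySeq u := by
  -- Any ratio `r ∈ (0, 1)` with `γ ≤ r ^ 2` works.
  obtain ⟨r, hr₀, hr₁, hγr⟩ : ∃ r : ℝ, 0 < r ∧ r < 1 ∧ γ ≤ r ^ 2 :=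
    ⟨(1 + γ) / 2, by linarith, by linarith, by nlinarith [sq_nonneg (1 - γ)]⟩
  obtain ⟨C, hC, h₀, h₁⟩ : ∃ C : ℝ, 0 ≤ C ∧ dist (u 0) (u 1) ≤ C ∧ dist (u 1) (u 2) ≤ C * r := by
    refine ⟨dist (u 0) (u 1) + dist (u 1) (u 2) / r, by positivity, ?_, ?_⟩
    · exact le_add_of_nonneg_right (by positivity)
    · rw [add_mul, div_mul_cancel₀ _ hr₀.ne']
      exact le_add_of_nonneg_left (by positivity)
  refine cauchySeq_of_le_geometric r C hr₁ fun n => ?_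
  induction n using Nat.twoStepInduction with
  | zero => simpa using h₀
  | one => simpa using h₁
  | more n ih₀ ih₁ =>
    have hstep : C * r ^ (n + 1) ≤ C * r ^ n :=
      mul_le_mul_of_nonneg_left (pow_le_pow_of_le_one hr₀.le hr₁.le n.le_succ) hC
    calc dist (u (n + 2)) (u (n + 3))
        ≤ γ * max (dist (u n) (u (n + 1))) (dist (u (n + 1)) (u (n + 2))) := hu n
      _ ≤ r ^ 2 * (C * r ^ n) := by
        gcongr
        exact max_le ih₀ (ih₁.trans hstep)
      _ = C * r ^ (n + 2) := by ring


/-- For a generalized Ćirić–Reich–Rus type mapping without periodic points of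
prime period 2, if no iterate of x₀ is a fixed point, then the iteration
sequence satisfies a geometric-type estimate and is Cauchy. -/
theorem generalized_crr_iterates_cauchy
    {X : Type*} [MetricSpace X]
    (h3 : ∃ p q r : X, p ≠ q ∧ p ≠ r ∧ q ≠ r)
    (T : X → X) (α lam : ℝ) (hα : 0 ≤ α) (hlam : 0 ≤ lam)
    (hsum : 2 * α + (3 / 2) * lam < 1)
    (hT : ∀ x y z : X, x ≠ y → y ≠ z → x ≠ z →
      dist (T x) (T y) + dist (T y) (T z) + dist (T x) (T z) ≤
        α * (dist x y + dist y z + dist z x) +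
        lam * (dist x (T x) + dist y (T y) + dist z (T z)))
    (hper : ∀ x : X, T x ≠ x → T (T x) ≠ x)
    (x₀ : X)
    (hnotfix : ∀ n : ℕ, T (T^[n] x₀) ≠ T^[n] x₀) :
    0 ≤ 2 * (2 * α + lam) / (2 - lam) ∧
    2 * (2 * α + lam) / (2 - lam) < 1 ∧
    (∀ n : ℕ, 2 ≤ n →
      dist (T^[n + 1] x₀) (T^[n + 2] x₀) ≤
        2 * (2 * α + lam) / (2 - lam) *
          max (dist (T^[n - 1] x₀) (T^[n] x₀)) (dist (T^[n] x₀) (T^[n + 1] x₀))) ∧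
    CauchySeq (fun n : ℕ => T^[n] x₀) := by
  have hden : 0 < 2 - lam := by linarith
  have hγ₀ : 0 ≤ 2 * (2 * α + lam) / (2 - lam) := by positivity
  have hγ₁ : 2 * (2 * α + lam) / (2 - lam) < 1 := by
    rw [div_lt_one hden]
    linarith
  have hstep (x : X) (hx : T x ≠ x) (hTx : T (T x) ≠ T x) :
      dist (T (T x)) (T (T (T x))) ≤
        2 * (2 * α + lam) / (2 - lam) * max (dist x (T x)) (dist (T x) (T (T x))) := by
    have key := hT x (T x) (T (T x)) hx.symm hTx.symm (hper x hx).symm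
    have hlow : dist (T (T x)) (T (T (T x))) ≤
        dist (T x) (T (T x)) + dist (T x) (T (T (T x))) := dist_triangle_left _ _ _
    have hα' := mul_le_mul_of_nonneg_left (dist_triangle x (T x) (T (T x))) hα
    have hmax : (2 * α + lam) * (dist x (T x) + dist (T x) (T (T x))) ≤
        (2 * α + lam) * (2 * max (dist x (T x)) (dist (T x) (T (T x)))) := by
      gcongr
      linarith [le_max_left (dist x (T x)) (dist (T x) (T (T x))),
        le_max_right (dist x (T x)) (dist (T x) (T (T x)))]
    rw [dist_comm (T (T x)) x] at key
    rw [div_mul_eq_mul_div, le_div_iff₀ hden]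
    linarith
  have hiter (n : ℕ) : dist (T^[n + 2] x₀) (T^[n + 3] x₀) ≤
      2 * (2 * α + lam) / (2 - lam) *
        max (dist (T^[n] x₀) (T^[n + 1] x₀)) (dist (T^[n + 1] x₀) (T^[n + 2] x₀)) := by
    have hn := hnotfix (n + 1)
    simp only [Function.iterate_succ_apply'] at hn ⊢
    exact hstep _ (hnotfix n) hn
  refine ⟨hγ₀, hγ₁, fun n hn => ?_, cauchySeq_of_dist_le_mul_max hγ₀ hγ₁ hiter⟩
  obtain ⟨m, rfl⟩ : ∃ m, n = m + 1 := ⟨n - 1, by omega⟩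
  exact hiter m
end

section
/- Let (X,d) be a metric space with at least 3 points, and let T : X → X be a generalized Ćirić–Reich–Rus type mapping with coefficients α, λ ≥ 0 satisfying 2α + (3/2)λ < 1. Suppose x* is a fixed point of T which is the limit of an iteration sequence x₀, x₁ = Tx₀, x₂ = Tx₁, … such that x_n ≠ x* for all n ≥ 1. Then x* is the unique fixed point of T. -/
open Filter Topology

/-- If a fixed point x* of a generalized Ćirić–Reich–Rus type mapping is the
limit of an iteration sequence whose terms (from index 1 on) are all distinct
from x*, then x* is the unique fixed point. -/
theorem generalized_crr_unique_fixed_point_of_iteration_limit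
    {X : Type*} [MetricSpace X]
    (h3 : ∃ p q r : X, p ≠ q ∧ p ≠ r ∧ q ≠ r)
    (T : X → X) (α lam : ℝ) (hα : 0 ≤ α) (hlam : 0 ≤ lam)
    (hsum : 2 * α + (3 / 2) * lam < 1)
    (hT : ∀ x y z : X, x ≠ y → y ≠ z → x ≠ z →
      dist (T x) (T y) + dist (T y) (T z) + dist (T x) (T z) ≤
        α * (dist x y + dist y z + dist z x) +
        lam * (dist x (T x) + dist y (T y) + dist z (T z)))
    (xstar : X) (hfix : T xstar = xstar)
    (x₀ : X)
    (hlim : Tendsto (fun n : ℕ => T^[n] x₀) atTop (𝓝 xstar))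
    (hne : ∀ n : ℕ, 1 ≤ n → T^[n] x₀ ≠ xstar) :
    ∀ y : X, T y = y → y = xstar := by
  intro y hy
  by_contra hyx
  have hlim' : Tendsto (fun n : ℕ => T (T^[n] x₀)) atTop (𝓝 xstar) := by
    simpa only [Function.comp_def, Function.iterate_succ_apply'] using
      hlim.comp (tendsto_add_atTop_nat 1)
  have hle : ∀ᶠ n : ℕ in atTop,
      dist xstar y + dist y (T (T^[n] x₀)) + dist xstar (T (T^[n] x₀)) ≤
        α * (dist xstar y + dist y (T^[n] x₀) + dist (T^[n] x₀) xstar) +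
          lam * dist (T^[n] x₀) (T (T^[n] x₀)) := by
    filter_upwards [eventually_ge_atTop 1, hlim.eventually_ne (Ne.symm hyx)] with n hn hny
    simpa [hfix, hy] using hT xstar y (T^[n] x₀) (Ne.symm hyx) hny.symm (hne n hn).symm
  have key := le_of_tendsto_of_tendsto
    (((tendsto_const_nhds (x := dist xstar y)).add
      ((tendsto_const_nhds (x := y)).dist hlim')).add
        ((tendsto_const_nhds (x := xstar)).dist hlim'))
    (((((tendsto_const_nhds (x := dist xstar y)).add
      ((tendsto_const_nhds (x := y)).dist hlim)).add
        (hlim.dist (tendsto_const_nhds (x := xstar)))).const_mul α).add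
          ((hlim.dist hlim').const_mul lam))
    hle
  have hpos : 0 < dist xstar y := dist_pos.mpr (Ne.symm hyx)
  rw [dist_self, dist_comm y xstar] at key
  nlinarith
end

section
/- Let (X,d) be a complete metric space with at least 3 points, and let T : X → X be a mapping contracting perimeters of triangles with coefficient α ∈ [0, 1/2), i.e., d(Tx,Ty) + d(Ty,Tz) + d(Tx,Tz) ≤ α(d(x,y) + d(y,z) + d(x,z)) for all pairwise distinct x, y, z ∈ X. Suppose T has no periodic points of prime period 2, i.e., T(T(x)) ≠ x whenever Tx ≠ x. Then T has a fixed point, and the number of fixed points of T is at most two. -/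
open Filter Topology in
/-- A mapping contracting perimeters of triangles on a nonempty complete metric space has a fixed
point as soon as it has no points of prime period `2`. -/
theorem exists_fixed_point_of_contracting_perimeters
    {X : Type*} [MetricSpace X] [CompleteSpace X] (p : X)
    (T : X → X) (α : ℝ) (hα0 : 0 ≤ α) (hα1 : α < 1)
    (hT : ∀ x y z : X, x ≠ y → y ≠ z → x ≠ z →
      dist (T x) (T y) + dist (T y) (T z) + dist (T x) (T z) ≤
        α * (dist x y + dist y z + dist x z))
    (hper : ∀ x : X, T x ≠ x → T (T x) ≠ x) :
    ∃ x : X, T x = x := by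
  by_contra! hfix
  set P : X → ℝ := fun x => dist x (T x) + dist (T x) (T (T x)) + dist x (T (T x)) with hP
  have hPT (x : X) : P (T x) ≤ α * P x :=
    hT x (T x) (T (T x)) (hfix x).symm (hfix _).symm (hper x (hfix x)).symm
  have hdP (x : X) : dist x (T x) ≤ P x := by
    have h1 := dist_nonneg (x := T x) (y := T (T x))
    have h2 := dist_nonneg (x := x) (y := T (T x))
    simp only [hP]
    linarith
  have hPpos (x : X) : 0 < P x := (dist_pos.2 (hfix x).symm).trans_le (hdP x)
  set u : ℕ → X := fun n => T^[n] p with hu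
  have hus (n : ℕ) : u (n + 1) = T (u n) := Function.iterate_succ_apply' T n p
  have hPu (n : ℕ) : P (u n) ≤ P p * α ^ n := by
    induction n with
    | zero => simp [hu]
    | succ n ih =>
      rw [hus]
      calc P (T (u n)) ≤ α * P (u n) := hPT _
        _ ≤ α * (P p * α ^ n) := by gcongr
        _ = P p * α ^ (n + 1) := by ring
  have hinj : Function.Injective u := by
    have hanti : StrictAnti fun n => P (u n) := by
      refine strictAnti_nat_of_succ_lt fun n => ?_
      rw [hus]
      nlinarith [hPT (u n), hPpos (u n)]
    exact fun m n h => hanti.injective (congrArg P h)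
  have hcauchy : CauchySeq u := by
    refine cauchySeq_of_le_geometric α (P p) hα1 fun n => ?_
    rw [hus]
    exact (hdP _).trans (hPu n)
  obtain ⟨x, hx⟩ := cauchySeq_tendsto_of_complete hcauchy
  have hx1 : Tendsto (fun n => u (n + 1)) atTop (𝓝 x) := hx.comp (tendsto_add_atTop_nat 1)
  have hne : ∀ᶠ n in atTop, u n ≠ x := by
    rw [← Nat.cofinite_eq_atTop]
    exact hinj.tendsto_cofinite.eventually (eventually_cofinite_ne x)
  have hne1 : ∀ᶠ n in atTop, u (n + 1) ≠ x := (tendsto_add_atTop_nat 1).eventually hne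
  have hbound : ∀ᶠ n in atTop, dist (u (n + 1)) (T x) ≤
      α * (dist (u n) (u (n + 1)) + dist (u (n + 1)) x + dist (u n) x) := by
    filter_upwards [hne, hne1] with n h0 h1
    have hn : u n ≠ u (n + 1) := by
      rw [hus]
      exact (hfix _).symm
    have h := hT (u n) (u (n + 1)) x hn h1 h0
    rw [← hus n] at h
    linarith [dist_nonneg (x := u (n + 1)) (y := T (u (n + 1))),
      dist_nonneg (x := T (u (n + 1))) (y := T x)]
  have hlim : Tendsto
      (fun n => α * (dist (u n) (u (n + 1)) + dist (u (n + 1)) x + dist (u n) x))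
      atTop (𝓝 0) := by
    have hx' : Tendsto (fun _ : ℕ => x) atTop (𝓝 x) := tendsto_const_nhds
    simpa using (((hx.dist hx1).add (hx1.dist hx')).add (hx.dist hx')).const_mul α
  have hle : dist x (T x) ≤ 0 :=
    le_of_tendsto_of_tendsto (hx1.dist tendsto_const_nhds) hlim hbound
  exact hfix x (dist_le_zero.1 hle).symm

/-- A mapping contracting perimeters of triangles with coefficient α ∈ [0,1/2)
on a complete metric space with at least 3 points, having no periodic points of
prime period 2, has a fixed point, and at most two fixed points. -/
theorem contracting_perimeters_fixed_point
    {X : Type*} [MetricSpace X] [CompleteSpace X]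
    (h3 : ∃ p q r : X, p ≠ q ∧ p ≠ r ∧ q ≠ r)
    (T : X → X) (α : ℝ) (hα0 : 0 ≤ α) (hα1 : α < 1 / 2)
    (hT : ∀ x y z : X, x ≠ y → y ≠ z → x ≠ z →
      dist (T x) (T y) + dist (T y) (T z) + dist (T x) (T z) ≤
        α * (dist x y + dist y z + dist x z))
    (hper : ∀ x : X, T x ≠ x → T (T x) ≠ x) :
    (∃ x : X, T x = x) ∧
    (∀ x y z : X, T x = x → T y = y → T z = z → x = y ∨ y = z ∨ x = z) := by
  obtain ⟨p, -⟩ := h3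
  refine ⟨exists_fixed_point_of_contracting_perimeters p T α hα0 (by linarith) hT hper, ?_⟩
  intro x y z hx hy hz
  by_contra! ⟨hxy, hyz, hxz⟩
  have h := hT x y z hxy hyz hxz
  rw [hx, hy, hz] at h
  nlinarith [dist_pos.2 hxy, dist_pos.2 hyz, dist_pos.2 hxz]
end

section
/- Let (X,d) be a complete metric space with at least 3 points, and let T : X → X be a generalized Kannan type mapping with coefficient λ ∈ [0, 2/3), i.e., d(Tx,Ty) + d(Ty,Tz) + d(Tx,Tz) ≤ λ(d(x,Tx) + d(y,Ty) + d(z,Tz)) for all pairwise distinct x, y, z ∈ X. Suppose T has no periodic points of prime period 2, i.e., T(T(x)) ≠ x whenever Tx ≠ x. Then T has a fixed point, and the number of fixed points of T is at most two. -/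
open Filter in
/-- A generalized Kannan type mapping with coefficient λ ∈ [0,2/3) on a
complete metric space with at least 3 points, having no periodic points of
prime period 2, has a fixed point, and at most two fixed points. -/
theorem generalized_kannan_fixed_point
    {X : Type*} [MetricSpace X] [CompleteSpace X]
    (h3 : ∃ p q r : X, p ≠ q ∧ p ≠ r ∧ q ≠ r)
    (T : X → X) (lam : ℝ) (hlam0 : 0 ≤ lam) (hlam1 : lam < 2 / 3)
    (hT : ∀ x y z : X, x ≠ y → y ≠ z → x ≠ z →
      dist (T x) (T y) + dist (T y) (T z) + dist (T x) (T z) ≤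
        lam * (dist x (T x) + dist y (T y) + dist z (T z)))
    (hper : ∀ x : X, T x ≠ x → T (T x) ≠ x) :
    (∃ x : X, T x = x) ∧
    (∀ x y z : X, T x = x → T y = y → T z = z → x = y ∨ y = z ∨ x = z) := by
  refine ⟨?_, ?_⟩
  · by_contra! hfix
    obtain ⟨x₀, -⟩ := h3
    obtain ⟨α, hα0, hα1, hα⟩ : ∃ α : ℝ, 0 ≤ α ∧ α < 1 ∧ α * (2 * (1 - lam)) = lam := by
      have hpos : 0 < 2 * (1 - lam) := by linarith
      exact ⟨lam / (2 * (1 - lam)), by positivity, by rw [div_lt_one hpos]; linarith,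
        div_mul_cancel₀ _ hpos.ne'⟩
    have contract : ∀ x, dist (T x) (T (T x)) ≤ α * dist x (T x) := by
      intro x
      have h := hT x (T x) (T (T x)) (hfix x).symm (hfix _).symm (hper x (hfix x)).symm
      have htri := dist_triangle_right (T x) (T (T x)) (T (T (T x)))
      have htri' := dist_triangle_left (T (T x)) (T (T (T x))) (T x)
      have hmul : dist (T x) (T (T x)) * (2 * (1 - lam)) ≤ lam * dist x (T x) := by
        rcases le_total (dist (T x) (T (T x))) (dist (T (T x)) (T (T (T x)))) with hle | hle <;>
          nlinarith
      refine le_of_mul_le_mul_right (a := 2 * (1 - lam)) ?_ (by linarith)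
      calc _ ≤ lam * dist x (T x) := hmul
        _ = _ := by nth_rewrite 1 [← hα]; ring
    set u : ℕ → X := fun n => T^[n] x₀ with hu
    have hsucc : ∀ n, u (n + 1) = T (u n) := fun n => Function.iterate_succ_apply' T n x₀
    have hgeom : ∀ n, dist (u n) (u (n + 1)) ≤ dist x₀ (T x₀) * α ^ n := by
      intro n
      induction n with
      | zero => simp [hu]
      | succ n ih =>
        have h := contract (u n)
        rw [← hsucc, ← hsucc] at h
        calc _ ≤ _ := h
          _ ≤ α * (dist x₀ (T x₀) * α ^ n) := by gcongr
          _ = _ := by ring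
    obtain ⟨p, hp⟩ := cauchySeq_tendsto_of_complete (cauchySeq_of_le_geometric α _ hα1 hgeom)
    have hanti : StrictAnti fun n => dist (u n) (T (u n)) := by
      refine strictAnti_nat_of_succ_lt fun n => ?_
      have hpos : 0 < dist (u n) (T (u n)) := dist_pos.2 (hfix _).symm
      have h := contract (u n)
      rw [hsucc]
      nlinarith
    have hinj : Function.Injective u := fun m n h => hanti.injective (by simp only [h])
    have hne : ∀ᶠ n in atTop, u n ≠ p := by
      rw [← Nat.cofinite_eq_atTop]
      exact hinj.tendsto_cofinite.eventually (Set.finite_singleton p).compl_mem_cofinite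
    have hp1 := hp.comp (tendsto_add_atTop_nat 1)
    have hp2 := hp.comp (tendsto_add_atTop_nat 2)
    have hlim := le_of_tendsto_of_tendsto
      (((hp1.dist hp2).add (hp2.dist tendsto_const_nhds)).add (hp1.dist tendsto_const_nhds))
      ((((hp.dist hp1).add (hp1.dist hp2)).add
        (tendsto_const_nhds (x := dist p (T p)))).const_mul lam)
      (by
        filter_upwards [hne, (tendsto_add_atTop_nat 1).eventually hne] with n h₀ h₁
        have h := hT (u n) (u (n + 1)) p (by rw [hsucc]; exact (hfix _).symm) h₁ h₀
        simp only [← hsucc] at h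
        exact h)
    simp only [dist_self, zero_add] at hlim
    have hpos : 0 < dist p (T p) := dist_pos.2 (hfix p).symm
    nlinarith
  · intro x y z hx hy hz
    by_contra! h
    obtain ⟨hxy, hyz, hxz⟩ := h
    have hsum := hT x y z hxy hyz hxz
    simp only [hx, hy, hz, dist_self, add_zero, mul_zero] at hsum
    have hpos := dist_pos.2 hxy
    have hyz0 := dist_nonneg (x := y) (y := z)
    have hxz0 := dist_nonneg (x := x) (y := z)
    linarith
end

section
/- Let (X,d) be a metric space with at least 3 points and let T : X → X be a generalized Ćirić–Reich–Rus type mapping with coefficients α, λ ≥ 0 satisfying 2α + (3/2)λ < 1. Then T is continuous at every fixed point of T; that is, if Tx* = x* and (x_n) is any sequence in X with x_n → x*, then Tx_n → Tx*. -/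
open Filter Topology

/-- Generalized Ćirić–Reich–Rus type mappings are continuous at fixed points:
if Tx* = x* and xₙ → x*, then Txₙ → Tx*. -/
theorem generalized_crr_continuous_at_fixed_points
    {X : Type*} [MetricSpace X]
    (h3 : ∃ p q r : X, p ≠ q ∧ p ≠ r ∧ q ≠ r)
    (T : X → X) (α lam : ℝ) (hα : 0 ≤ α) (hlam : 0 ≤ lam)
    (hsum : 2 * α + (3 / 2) * lam < 1)
    (hT : ∀ x y z : X, x ≠ y → y ≠ z → x ≠ z →
      dist (T x) (T y) + dist (T y) (T z) + dist (T x) (T z) ≤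
        α * (dist x y + dist y z + dist z x) +
        lam * (dist x (T x) + dist y (T y) + dist z (T z))) :
    ∀ xstar : X, T xstar = xstar →
      ∀ u : ℕ → X, Tendsto u atTop (𝓝 xstar) →
        Tendsto (fun n => T (u n)) atTop (𝓝 (T xstar)) := by
  intro p hp u hu
  have pair_bound : ∀ x y : X, x ≠ y → x ≠ p → y ≠ p →
      dist (T x) p ≤ 3 * (dist x p + dist y p) := by
    intro x y hxy hx hy
    have h := hT x y p hxy hy hx
    rw [hp, dist_self, dist_comm p x] at h
    have hxT : dist x (T x) ≤ dist x p + dist (T x) p := dist_triangle_right _ _ _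
    have hyT : dist y (T y) ≤ dist y p + dist (T y) p := dist_triangle_right _ _ _
    have hxy' : dist x y ≤ dist x p + dist y p := dist_triangle_right _ _ _
    have hTxy : 0 ≤ dist (T x) (T y) := dist_nonneg
    have hTx : 0 ≤ dist (T x) p := dist_nonneg
    have hTy : 0 ≤ dist (T y) p := dist_nonneg
    have hx0 : 0 ≤ dist x p := dist_nonneg
    have hy0 : 0 ≤ dist y p := dist_nonneg
    have h₁ := mul_le_mul_of_nonneg_left hxy' hα
    have h₂ := mul_le_mul_of_nonneg_left (add_le_add hxT hyT) hlam
    have h₃ : lam * (dist (T x) p + dist (T y) p) ≤ 2 / 3 * (dist (T x) p + dist (T y) p) :=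
      mul_le_mul_of_nonneg_right (by linarith) (by positivity)
    have h₄ : (2 * α + lam) * (dist x p + dist y p) ≤ 1 * (dist x p + dist y p) :=
      mul_le_mul_of_nonneg_right (by linarith) (by positivity)
    linarith
  rw [hp, Metric.tendsto_nhds]
  rw [Metric.tendsto_nhds] at hu
  intro ε hε
  by_cases isolated : ∃ r > 0, ∀ y, dist y p < r → y = p
  · obtain ⟨r, hr, hisol⟩ := isolated
    filter_upwards [hu r hr] with n hn
    rw [hisol _ hn, hp, dist_self]
    exact hε
  · push Not at isolated
    filter_upwards [hu (ε / 6) (by positivity)] with n hn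
    by_cases hx : u n = p
    · rw [hx, hp, dist_self]
      exact hε
    · obtain ⟨y, hy, hyp⟩ := isolated (dist (u n) p) (dist_pos.mpr hx)
      have hne : u n ≠ y := by
        rintro rfl
        exact lt_irrefl _ hy
      linarith [pair_bound (u n) y hne hx hyp]
end

section
/- Let (X,d) be a complete metric space with at least 3 points, and let T : X → X be asymptotically regular (i.e., lim_{n→∞} d(T^{n+1}x, T^n x) = 0 for every x ∈ X) and satisfy, for some α ∈ [0, 1/2) and λ ∈ [0, 1), the inequality d(Tx,Ty) + d(Ty,Tz) + d(Tx,Tz) ≤ α(d(x,y) + d(y,z) + d(z,x)) + λ(d(x,Tx) + d(y,Ty) + d(z,Tz)) for all pairwise distinct x, y, z ∈ X. Then T has a fixed point, and the number of fixed points of T is at most two. -/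
open Filter Topology

/-- If consecutive distances along the orbit of a periodic point tend to zero,
then the point is fixed. -/
theorem isFixedPt_of_isPeriodicPt_of_tendsto_dist {X : Type*} [MetricSpace X] {T : X → X} {y : X}
    {p : ℕ} (hp : 0 < p) (hy : Function.IsPeriodicPt T p y)
    (har : Tendsto (fun n : ℕ => dist (T^[n + 1] y) (T^[n] y)) atTop (𝓝 0)) :
    Function.IsFixedPt T y := by
  have hsub : Tendsto (fun k : ℕ => p * k) atTop atTop :=
    tendsto_id.const_mul_atTop' hp
  have hconst : (fun n : ℕ => dist (T^[n + 1] y) (T^[n] y)) ∘ (fun k => p * k) =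
      fun _ => dist (T y) y := by
    funext k
    have hk : T^[p * k] y = y := hy.mul_const k
    simp only [Function.comp_apply, Function.iterate_succ_apply', hk]
  have hlim := har.comp hsub
  rw [hconst] at hlim
  exact dist_eq_zero.mp (tendsto_nhds_unique tendsto_const_nhds hlim)

/-- Orbits of a fixed-point-free asymptotically regular map have no repetitions. -/
theorem injective_iterate_of_tendsto_dist {X : Type*} [MetricSpace X] {T : X → X}
    (hfree : ∀ x, T x ≠ x)
    (har : ∀ x : X, Tendsto (fun n : ℕ => dist (T^[n + 1] x) (T^[n] x)) atTop (𝓝 0)) (x : X) :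
    Function.Injective (fun n : ℕ => T^[n] x) := by
  refine Function.Injective.of_lt_imp_ne fun m n hmn heq => ?_
  refine hfree _ (isFixedPt_of_isPeriodicPt_of_tendsto_dist (Nat.sub_pos_of_lt hmn) ?_
    (har (T^[m] x)))
  change T^[n - m] (T^[m] x) = T^[m] x
  rw [← Function.iterate_add_apply, Nat.sub_add_cancel hmn.le]
  exact heq.symm

/-- An injective sequence with vanishing consecutive distances whose shift satisfies the
three-point contraction inequality is Cauchy. -/
theorem cauchySeq_of_three_point_contraction {X : Type*} [MetricSpace X] {u : ℕ → X}
    (hinj : Function.Injective u)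
    (har : Tendsto (fun n : ℕ => dist (u (n + 1)) (u n)) atTop (𝓝 0))
    {α lam : ℝ} (hα1 : α < 1 / 2) (hlam1 : lam < 1)
    (hu : ∀ i j k : ℕ, u i ≠ u j → u j ≠ u k → u i ≠ u k →
      dist (u (i + 1)) (u (j + 1)) + dist (u (j + 1)) (u (k + 1)) + dist (u (i + 1)) (u (k + 1)) ≤
        α * (dist (u i) (u j) + dist (u j) (u k) + dist (u k) (u i)) +
        lam * (dist (u i) (u (i + 1)) + dist (u j) (u (j + 1)) + dist (u k) (u (k + 1)))) :
    CauchySeq u := by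
  rw [Metric.cauchySeq_iff]
  intro ε hε
  obtain ⟨N, hN⟩ := eventually_atTop.mp (har.eventually_lt_const (by positivity : 0 < ε / 10))
  refine ⟨N, fun n hn m hm => ?_⟩
  have en := hN n hn
  have em := hN m hm
  have en' := hN (n + 1) (by omega)
  rw [dist_comm] at en em en'
  by_cases hnm : n = m
  · simpa [hnm] using hε
  by_cases hnm' : n + 1 = m
  · subst hnm'
    linarith
  have key := hu n m (n + 1) (hinj.ne hnm) (hinj.ne (Ne.symm hnm')) (hinj.ne (by omega))
  have lower : dist (u n) (u m) ≤
      dist (u n) (u (n + 1)) + dist (u (n + 1)) (u (m + 1)) + dist (u m) (u (m + 1)) := by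
    simpa [dist_comm (u (m + 1)) (u m)] using dist_triangle4 (u n) (u (n + 1)) (u (m + 1)) (u m)
  have lower' : dist (u (n + 1)) (u (m + 1)) ≤
      dist (u (n + 1)) (u (n + 1 + 1)) + dist (u (m + 1)) (u (n + 1 + 1)) := by
    simpa [dist_comm (u (m + 1))] using
      dist_triangle (u (n + 1)) (u (n + 1 + 1)) (u (m + 1))
  have upper : dist (u m) (u (n + 1)) ≤ dist (u n) (u m) + dist (u n) (u (n + 1)) := by
    simpa [dist_comm (u m) (u n)] using dist_triangle (u m) (u n) (u (n + 1))
  have hα : α * (dist (u n) (u m) + dist (u m) (u (n + 1)) + dist (u (n + 1)) (u n)) ≤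
      1 / 2 * (dist (u n) (u m) + dist (u m) (u (n + 1)) + dist (u (n + 1)) (u n)) :=
    mul_le_mul_of_nonneg_right hα1.le (by positivity)
  have hlam : lam * (dist (u n) (u (n + 1)) + dist (u m) (u (m + 1)) +
        dist (u (n + 1)) (u (n + 1 + 1))) ≤
      1 * (dist (u n) (u (n + 1)) + dist (u m) (u (m + 1)) + dist (u (n + 1)) (u (n + 1 + 1))) :=
    mul_le_mul_of_nonneg_right hlam1.le (by positivity)
  rw [dist_comm (u (n + 1)) (u n)] at key hα
  linarith

/-- An asymptotically regular generalized Ćirić–Reich–Rus type mapping with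
coefficients α ∈ [0,1/2), λ ∈ [0,1) on a complete metric space with at least 3
points has a fixed point, and at most two fixed points. -/
theorem asymptotically_regular_generalized_crr_fixed_point
    {X : Type*} [MetricSpace X] [CompleteSpace X]
    (h3 : ∃ p q r : X, p ≠ q ∧ p ≠ r ∧ q ≠ r)
    (T : X → X)
    (har : ∀ x : X,
      Tendsto (fun n : ℕ => dist (T^[n + 1] x) (T^[n] x)) atTop (𝓝 0))
    (α lam : ℝ) (hα0 : 0 ≤ α) (hα1 : α < 1 / 2) (hlam0 : 0 ≤ lam) (hlam1 : lam < 1)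
    (hT : ∀ x y z : X, x ≠ y → y ≠ z → x ≠ z →
      dist (T x) (T y) + dist (T y) (T z) + dist (T x) (T z) ≤
        α * (dist x y + dist y z + dist z x) +
        lam * (dist x (T x) + dist y (T y) + dist z (T z))) :
    (∃ x : X, T x = x) ∧
    (∀ x y z : X, T x = x → T y = y → T z = z → x = y ∨ y = z ∨ x = z) := by
  refine ⟨?_, fun x y z hx hy hz => ?_⟩
  · by_contra! hfree
    obtain ⟨x₀, -⟩ := h3
    let u : ℕ → X := fun n => T^[n] x₀
    have hsucc (n : ℕ) : T (u n) = u (n + 1) := (Function.iterate_succ_apply' T n x₀).symm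
    have hinj : Function.Injective u := injective_iterate_of_tendsto_dist hfree har x₀
    have hcauchy : CauchySeq u :=
      cauchySeq_of_three_point_contraction hinj (har x₀) hα1 hlam1 fun i j k hij hjk hik => by
        simpa only [hsucc] using hT (u i) (u j) (u k) hij hjk hik
    obtain ⟨a, ha⟩ := cauchySeq_tendsto_of_complete hcauchy
    have ha₁ : Tendsto (fun n => u (n + 1)) atTop (𝓝 a) := (tendsto_add_atTop_iff_nat 1).mpr ha
    have ha₂ : Tendsto (fun n => u (n + 2)) atTop (𝓝 a) := (tendsto_add_atTop_iff_nat 2).mpr ha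
    have hne : ∀ᶠ n in atTop, u n ≠ a := by
      have h := hinj.tendsto_cofinite.eventually (eventually_cofinite_ne a)
      rwa [Nat.cofinite_eq_atTop] at h
    have hineq : ∀ᶠ n in atTop,
        dist (T a) (u (n + 1)) + dist (u (n + 1)) (u (n + 2)) + dist (T a) (u (n + 2)) ≤
          α * (dist a (u n) + dist (u n) (u (n + 1)) + dist (u (n + 1)) a) +
          lam * (dist a (T a) + dist (u n) (u (n + 1)) + dist (u (n + 1)) (u (n + 2))) := by
      filter_upwards [hne, (tendsto_add_atTop_nat 1).eventually hne] with n hn hn'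
      simpa only [hsucc] using
        hT a (u n) (u (n + 1)) hn.symm (hinj.ne n.succ_ne_self.symm) hn'.symm
    have hTa : Tendsto (fun _ : ℕ => T a) atTop (𝓝 (T a)) := tendsto_const_nhds
    have hca : Tendsto (fun _ : ℕ => a) atTop (𝓝 a) := tendsto_const_nhds
    have hlim := le_of_tendsto_of_tendsto
      (((hTa.dist ha₁).add (ha₁.dist ha₂)).add (hTa.dist ha₂))
      (((((hca.dist ha).add (ha.dist ha₁)).add (ha₁.dist hca)).const_mul α).add
        ((((hca.dist hTa).add (ha.dist ha₁)).add (ha₁.dist ha₂)).const_mul lam)) hineq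
    simp only [dist_self, add_zero, mul_zero, zero_add, dist_comm a (T a)] at hlim
    have hpos : 0 < dist (T a) a := dist_pos.mpr (hfree a)
    nlinarith
  · by_contra! hne
    obtain ⟨hxy, hyz, hxz⟩ := hne
    have h := hT x y z hxy hyz hxz
    simp only [hx, hy, hz, dist_self, add_zero, mul_zero, dist_comm z x] at h
    have hpos : 0 < dist x y + dist y z + dist x z := by
      have := dist_pos.mpr hxy
      positivity
    nlinarith
end

section
/- Let (X,d) be a complete metric space with at least 3 points, and let T : X → X be continuous and asymptotically regular. Suppose there exist α ∈ [0, 1/2) and a function F : ℝ≥0 × ℝ≥0 × ℝ≥0 → ℝ≥0 with F(0,0,0) = 0 and F continuous at (0,0,0), such that d(Tx,Ty) + d(Ty,Tz) + d(Tx,Tz) ≤ α(d(x,y) + d(y,z) + d(z,x)) + F(d(x,Tx), d(y,Ty), d(z,Tz)) for all pairwise distinct x, y, z ∈ X. Then T has a fixed point, and the number of fixed points of T is at most two. -/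
open Filter Topology NNReal

/-- A periodic point at which `T` is asymptotically regular is a fixed point. -/
theorem Function.IsPeriodicPt.isFixedPt_of_tendsto_dist {X : Type*} [MetricSpace X] {T : X → X}
    {p : ℕ} {y : X} (hper : Function.IsPeriodicPt T p y) (hp : 0 < p)
    (har : Tendsto (fun n : ℕ => dist (T^[n + 1] y) (T^[n] y)) atTop (𝓝 0)) :
    Function.IsFixedPt T y := by
  have hk : Tendsto (fun k : ℕ => p * k) atTop atTop := tendsto_id.const_mul_atTop' hp
  have hconst : ∀ k : ℕ, dist (T^[p * k + 1] y) (T^[p * k] y) = dist (T y) y := fun k => by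
    rw [Function.iterate_succ_apply', (hper.mul_const k).eq]
  have h := har.comp hk
  simp only [Function.comp_def, hconst] at h
  exact dist_eq_zero.mp (tendsto_nhds_unique tendsto_const_nhds h)

/-- An orbit of distinct points with vanishing consecutive distances is Cauchy if `T` satisfies a
generalized `F`-contraction condition on triples of distinct points. -/
theorem cauchySeq_iterate_of_generalized_F_crr {X : Type*} [MetricSpace X] {T : X → X} {x : X}
    (hinj : Function.Injective (fun n : ℕ => T^[n] x))
    (har : Tendsto (fun n : ℕ => dist (T^[n + 1] x) (T^[n] x)) atTop (𝓝 0))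
    {α : ℝ} (hα0 : 0 ≤ α) (hα1 : α < 1) {F : ℝ≥0 × ℝ≥0 × ℝ≥0 → ℝ≥0}
    (hF0 : F (0, 0, 0) = 0) (hFcont : ContinuousAt F (0, 0, 0))
    (hT : ∀ x y z : X, x ≠ y → y ≠ z → x ≠ z →
      dist (T x) (T y) + dist (T y) (T z) + dist (T x) (T z) ≤
        α * (dist x y + dist y z + dist z x) +
        (F (nndist x (T x), nndist y (T y), nndist z (T z)) : ℝ)) :
    CauchySeq (fun n : ℕ => T^[n] x) := by
  set u : ℕ → X := fun n => T^[n] x with hu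
  have hsucc : ∀ n, T (u n) = u (n + 1) := fun n => (Function.iterate_succ_apply' T n x).symm
  have hstep : Tendsto (fun n => nndist (u n) (u (n + 1))) atTop (𝓝 0) := by
    rw [← NNReal.tendsto_coe]
    simpa [hu, dist_comm] using har
  refine Metric.cauchySeq_iff.mpr fun ε hε => ?_
  obtain ⟨δ, hδ, hδε⟩ : ∃ δ > 0, 4 * δ < (1 - α) * ε :=
    ⟨(1 - α) * ε / 5, by have := mul_pos (sub_pos.mpr hα1) hε; positivity,
      by have := mul_pos (sub_pos.mpr hα1) hε; linarith⟩
  have hF : Tendsto (fun q => (F q : ℝ)) (𝓝 (0, 0, 0)) (𝓝 0) := by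
    have h := (NNReal.continuous_coe.tendsto _).comp hFcont.tendsto
    simpa [hF0, Function.comp_def] using h
  have hFδ : ∀ᶠ q in 𝓝 (0 : ℝ≥0) ×ˢ 𝓝 (0 : ℝ≥0) ×ˢ 𝓝 (0 : ℝ≥0), (F q : ℝ) < δ := by
    rw [← nhds_prod_eq, ← nhds_prod_eq]
    exact hF.eventually_lt_const hδ
  have hFu := (hstep.prodMap (hstep.prodMap hstep)).eventually hFδ
  rw [prod_atTop_atTop_eq, prod_atTop_atTop_eq] at hFu
  obtain ⟨⟨N₁, N₂, N₃⟩, hN⟩ := eventually_atTop.mp hFu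
  have hreal : Tendsto (fun n => dist (u n) (u (n + 1))) atTop (𝓝 0) := by
    simpa [hu, dist_comm] using har
  obtain ⟨M, hM⟩ := eventually_atTop.mp (hreal.eventually_lt_const hδ)
  refine ⟨max M (max N₁ (max N₂ N₃)), fun m hm n hn => ?_⟩
  simp only [ge_iff_le, max_le_iff] at hm hn
  have hδε' : δ < ε := by nlinarith
  rcases eq_or_ne m n with rfl | hmn
  · simpa using hε
  rcases eq_or_ne m (n + 1) with rfl | hmn'
  · rw [dist_comm]
    exact (hM n (by omega)).trans hδε'
  have h := hT (u m) (u n) (u (n + 1)) (hinj.ne hmn) (hinj.ne (by omega)) (hinj.ne hmn')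
  have hf := hN (m, n, n + 1) ⟨by dsimp; omega, by dsimp; omega, by dsimp; omega⟩
  simp only [Prod.map] at hf
  simp only [hsucc] at h
  have a := hM m (by omega)
  have b := hM n (by omega)
  have c := hM (n + 1) (by omega)
  have t₁ := dist_triangle4 (u m) (u (m + 1)) (u (n + 1)) (u n)
  have t₂ := dist_triangle4 (u m) (u (m + 1)) (u (n + 1 + 1)) (u (n + 1))
  have t₃ := dist_triangle (u m) (u (n + 1)) (u n)
  have t₄ := dist_triangle (u m) (u n) (u (n + 1))
  rw [dist_comm (u (n + 1)) (u n)] at t₁ t₃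
  rw [dist_comm (u (n + 1 + 1)) (u (n + 1))] at t₂
  rw [dist_comm (u (n + 1)) (u m)] at h
  have hα : α * (dist (u m) (u n) + dist (u n) (u (n + 1)) + dist (u m) (u (n + 1))) ≤
      α * (2 * dist (u m) (u n)) + 2 * δ := by
    nlinarith [dist_nonneg (x := u n) (y := u (n + 1))]
  nlinarith

/-- A continuous, asymptotically regular generalized F-Ćirić–Reich–Rus type
mapping on a complete metric space with at least 3 points has a fixed point,
and at most two fixed points. -/
theorem generalized_F_crr_fixed_point
    {X : Type*} [MetricSpace X] [CompleteSpace X]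
    (h3 : ∃ p q r : X, p ≠ q ∧ p ≠ r ∧ q ≠ r)
    (T : X → X) (hcont : Continuous T)
    (har : ∀ x : X,
      Tendsto (fun n : ℕ => dist (T^[n + 1] x) (T^[n] x)) atTop (𝓝 0))
    (α : ℝ) (hα0 : 0 ≤ α) (hα1 : α < 1 / 2)
    (F : ℝ≥0 × ℝ≥0 × ℝ≥0 → ℝ≥0)
    (hF0 : F (0, 0, 0) = 0)
    (hFcont : ContinuousAt F (0, 0, 0))
    (hT : ∀ x y z : X, x ≠ y → y ≠ z → x ≠ z →
      dist (T x) (T y) + dist (T y) (T z) + dist (T x) (T z) ≤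
        α * (dist x y + dist y z + dist z x) +
        (F (nndist x (T x), nndist y (T y), nndist z (T z)) : ℝ)) :
    (∃ x : X, T x = x) ∧
    (∀ x y z : X, T x = x → T y = y → T z = z → x = y ∨ y = z ∨ x = z) := by
  refine ⟨?_, fun x y z hx hy hz => ?_⟩
  · obtain ⟨x, -⟩ := h3
    by_cases hinj : Function.Injective (fun n : ℕ => T^[n] x)
    · obtain ⟨y, hy⟩ := cauchySeq_tendsto_of_complete
        (cauchySeq_iterate_of_generalized_F_crr hinj (har x) hα0 (by linarith) hF0 hFcont hT)
      exact ⟨y, isFixedPt_of_tendsto_iterate hy hcont.continuousAt⟩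
    · obtain ⟨m, n, hlt, hmn⟩ : ∃ m n, m < n ∧ T^[m] x = T^[n] x := by
        simp only [Function.Injective, not_forall] at hinj
        obtain ⟨m, n, h, hne⟩ := hinj
        rcases lt_or_gt_of_ne hne with hlt | hlt
        exacts [⟨m, n, hlt, h⟩, ⟨n, m, hlt, h.symm⟩]
      have hper : Function.IsPeriodicPt T (n - m) (T^[m] x) := by
        rw [Function.IsPeriodicPt, Function.IsFixedPt, ← Function.iterate_add_apply,
          Nat.sub_add_cancel hlt.le, hmn]
      exact ⟨_, hper.isFixedPt_of_tendsto_dist (by omega) (har _)⟩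
  · by_contra! hne
    obtain ⟨hxy, hyz, hxz⟩ := hne
    have h := hT x y z hxy hyz hxz
    simp only [hx, hy, hz, nndist_self, hF0, NNReal.coe_zero, dist_comm z x] at h
    nlinarith [dist_pos.mpr hxy, dist_pos.mpr hyz, dist_pos.mpr hxz]
end

section
/- Let (X,d) be a complete metric space with at least 3 points, and let T : X → X be continuous and asymptotically regular. Suppose there exist α ∈ [0, 1/2) and λ ∈ [0, ∞) such that d(Tx,Ty) + d(Ty,Tz) + d(Tx,Tz) ≤ α(d(x,y) + d(y,z) + d(z,x)) + λ(d(x,Tx) + d(y,Ty) + d(z,Tz)) for all pairwise distinct x, y, z ∈ X. Then T has a fixed point, and the number of fixed points of T is at most two. -/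
open Filter Topology

/-- A three-point inequality bounds the distance between two points that `T` almost fixes,
provided `T` also almost fixes the image of one of them. -/
lemma dist_le_of_three_point {X : Type*} [MetricSpace X] {T : X → X}
    {α lam ε : ℝ} (hα1 : α < 1 / 2) (hlam : 0 ≤ lam)
    (hT : ∀ x y z : X, x ≠ y → y ≠ z → x ≠ z →
      dist (T x) (T y) + dist (T y) (T z) + dist (T x) (T z) ≤
        α * (dist x y + dist y z + dist z x) +
        lam * (dist x (T x) + dist y (T y) + dist z (T z)))
    {u v : X} (hu : T u ≠ u) (h₁ : dist u (T u) ≤ ε) (h₂ : dist v (T v) ≤ ε)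
    (h₃ : dist (T u) (T (T u)) ≤ ε) : dist u v ≤ (6 + 3 * lam) * ε := by
  have hε : 0 ≤ ε := dist_nonneg.trans h₁
  have hlε : 0 ≤ lam * ε := mul_nonneg hlam hε
  by_cases huv : u = v
  · rw [huv, dist_self]
    positivity
  by_cases hv : v = T u
  · rw [hv]
    linarith
  have h := hT u v (T u) huv hv (Ne.symm hu)
  have t₁ : dist u v ≤ dist u (T u) + dist (T u) (T v) + dist (T v) v := dist_triangle4 ..
  have t₂ : dist (T u) v ≤ dist (T u) (T (T u)) + dist (T (T u)) (T v) + dist (T v) v :=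
    dist_triangle4 ..
  have t₃ : dist u v ≤ dist u (T u) + dist (T u) v := dist_triangle ..
  have t₄ : dist v (T u) ≤ dist v u + dist u (T u) := dist_triangle ..
  rw [dist_comm (T v) v] at t₁ t₂
  rw [dist_comm (T (T u)) (T v)] at t₂
  rw [dist_comm v u] at t₄
  rw [dist_comm (T u) u] at h
  have hα : α * (dist u v + dist v (T u) + dist u (T u)) ≤ 1 / 2 * (2 * dist u v + 2 * ε) :=
    mul_le_mul hα1.le (by linarith) (by positivity) (by norm_num)
  have hl : lam * (dist u (T u) + dist v (T v) + dist (T u) (T (T u))) ≤ lam * (3 * ε) :=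
    mul_le_mul_of_nonneg_left (by linarith) hlam
  linarith [dist_nonneg (x := T u) (y := T (T u))]

/-- A continuous, asymptotically regular generalized Ćirić–Reich–Rus type
mapping with α ∈ [0,1/2) and λ ∈ [0,∞) on a complete metric space with at
least 3 points has a fixed point, and at most two fixed points. -/
theorem continuous_asymptotically_regular_generalized_crr_fixed_point
    {X : Type*} [MetricSpace X] [CompleteSpace X]
    (h3 : ∃ p q r : X, p ≠ q ∧ p ≠ r ∧ q ≠ r)
    (T : X → X) (hcont : Continuous T)
    (har : ∀ x : X,
      Tendsto (fun n : ℕ => dist (T^[n + 1] x) (T^[n] x)) atTop (𝓝 0))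
    (α lam : ℝ) (hα0 : 0 ≤ α) (hα1 : α < 1 / 2) (hlam : 0 ≤ lam)
    (hT : ∀ x y z : X, x ≠ y → y ≠ z → x ≠ z →
      dist (T x) (T y) + dist (T y) (T z) + dist (T x) (T z) ≤
        α * (dist x y + dist y z + dist z x) +
        lam * (dist x (T x) + dist y (T y) + dist z (T z))) :
    (∃ x : X, T x = x) ∧
    (∀ x y z : X, T x = x → T y = y → T z = z → x = y ∨ y = z ∨ x = z) := by
  refine ⟨?_, fun x y z hx hy hz => ?_⟩
  · obtain ⟨x₀, -⟩ := h3
    by_contra! hfix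
    have hcauchy : CauchySeq (fun n : ℕ => T^[n] x₀) := by
      refine Metric.cauchySeq_iff.2 fun ε hε => ?_
      have hη : 0 < ε / (7 + 3 * lam) := by positivity
      obtain ⟨N, hN⟩ := eventually_atTop.1 ((har x₀).eventually_le_const hη)
      have hstep : ∀ n ≥ N, dist (T^[n] x₀) (T (T^[n] x₀)) ≤ ε / (7 + 3 * lam) := fun n hn => by
        rw [← Function.iterate_succ_apply' T n x₀, dist_comm]
        exact hN n hn
      refine ⟨N, fun m hm n hn => ?_⟩
      have hsucc := hstep (m + 1) (by omega)
      rw [Function.iterate_succ_apply'] at hsucc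
      calc dist (T^[m] x₀) (T^[n] x₀) ≤ (6 + 3 * lam) * (ε / (7 + 3 * lam)) :=
            dist_le_of_three_point hα1 hlam hT (hfix _) (hstep m hm) (hstep n hn) hsucc
        _ < (7 + 3 * lam) * (ε / (7 + 3 * lam)) := by gcongr; norm_num
        _ = ε := by field_simp
    obtain ⟨p, hp⟩ := cauchySeq_tendsto_of_complete hcauchy
    exact hfix p (isFixedPt_of_tendsto_iterate hp hcont.continuousAt)
  · by_contra! hne
    obtain ⟨hxy, hyz, hxz⟩ := hne
    have h := hT x y z hxy hyz hxz
    simp only [hx, hy, hz, dist_self, add_zero, mul_zero, dist_comm z x] at h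
    have hpos : 0 < dist x y + dist y z + dist x z := by
      have := dist_pos.2 hxy
      positivity
    nlinarith
end

section
/- Let (X,d) be a complete metric space with at least 3 points, and let T : X → X be continuous and asymptotically regular. Suppose there exist a function φ : [0,∞) → [0,∞) which is upper semi-continuous and satisfies φ(t) < t for all t > 0, and a function F : ℝ≥0 × ℝ≥0 × ℝ≥0 → ℝ≥0 with F(0,0,0) = 0 and F continuous at (0,0,0), such that d(Tx,Ty) + d(Ty,Tz) + d(Tx,Tz) ≤ φ(max{d(x,y), d(y,z), d(z,x)}) + F(d(x,Tx), d(y,Ty), d(z,Tz)) for all pairwise distinct x, y, z ∈ X. Then T has a fixed point, and the number of fixed points of T is at most two. -/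
open Filter Topology NNReal

/-- An orbit of an asymptotically regular self-map of a metric space without fixed points never
revisits a point. -/
theorem iterate_injective_of_asymptotically_regular {X : Type*} [MetricSpace X] {T : X → X}
    (har : ∀ x : X,
      Tendsto (fun n : ℕ => dist (T^[n + 1] x) (T^[n] x)) atTop (𝓝 0))
    (hfix : ∀ x, T x ≠ x) (x : X) : Function.Injective fun n : ℕ => T^[n] x := by
  refine Function.Injective.of_lt_imp_ne fun n m hnm heq => ?_
  obtain ⟨p, hp, rfl⟩ : ∃ p, 0 < p ∧ m = p + n := ⟨m - n, by omega, by omega⟩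
  set y := T^[n] x with hy
  have hper : Function.IsPeriodicPt T p y := by
    change T^[p] y = y
    rw [hy, ← Function.iterate_add_apply]
    exact heq.symm
  have hconst (k : ℕ) : dist (T^[p * k + 1] y) (T^[p * k] y) = dist (T y) y := by
    have hk : T^[p * k] y = y := hper.mul_const k
    rw [Function.iterate_succ_apply', hk]
  have hmul : Tendsto (fun k : ℕ => p * k) atTop atTop :=
    tendsto_id.const_mul_atTop' hp
  have hlim := (har y).comp hmul
  simp only [Function.comp_def, hconst] at hlim
  exact hfix y (dist_eq_zero.1 (tendsto_nhds_unique tendsto_const_nhds hlim))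

/-- An injective sequence with vanishing consecutive distances, satisfying a three-point
contractive inequality along triples `n, n + 1, m`, is Cauchy. -/
theorem cauchySeq_of_three_point_contraction_s14 {X : Type*} [MetricSpace X] {u : ℕ → X}
    (hreg : Tendsto (fun n => dist (u (n + 1)) (u n)) atTop (𝓝 0))
    {φ : ℝ≥0 → ℝ≥0} (hφusc : UpperSemicontinuous φ) (hφlt : ∀ t : ℝ≥0, 0 < t → φ t < t)
    {F : ℝ≥0 × ℝ≥0 × ℝ≥0 → ℝ≥0} (hF0 : F (0, 0, 0) = 0) (hFcont : ContinuousAt F (0, 0, 0))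
    (hu : ∀ n m, n + 1 < m →
      dist (u (n + 1)) (u (n + 2)) + dist (u (n + 2)) (u (m + 1)) +
          dist (u (n + 1)) (u (m + 1)) ≤
        (φ (max (nndist (u n) (u (n + 1)))
          (max (nndist (u (n + 1)) (u m)) (nndist (u m) (u n)))) : ℝ) +
        (F (nndist (u n) (u (n + 1)), nndist (u (n + 1)) (u (n + 2)),
          nndist (u m) (u (m + 1))) : ℝ)) :
    CauchySeq u := by
  rw [Metric.cauchySeq_iff']
  by_contra! hcauchy
  obtain ⟨ε, hε, hfar⟩ := hcauchy
  lift ε to ℝ≥0 using hε.le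
  have hε' : 0 < ε := hε
  obtain ⟨δ, hδ, hφδ⟩ := Metric.eventually_nhds_iff.1 (hφusc ε ε (hφlt ε hε'))
  obtain ⟨γ, hγ, hFγ⟩ := Metric.continuousAt_iff.1 hFcont (ε / 4 : ℝ) (by positivity)
  obtain ⟨η, hη, hη_lt⟩ : ∃ η : ℝ, 0 < η ∧ η ≤ δ / 2 ∧ η ≤ γ ∧ η ≤ ε / 10 :=
    ⟨min (δ / 2) (min γ (ε / 10)), by positivity, min_le_left _ _,
      (min_le_right _ _).trans (min_le_left _ _), (min_le_right _ _).trans (min_le_right _ _)⟩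
  obtain ⟨hηδ, hηγ, hηε⟩ := hη_lt
  obtain ⟨n, hn⟩ := eventually_atTop.1 (hreg.eventually_lt_const hη)
  have hex := hfar n
  classical
  obtain ⟨hnm, hm⟩ := Nat.find_spec hex
  have hmin := fun k => Nat.find_min hex (m := k)
  generalize Nat.find hex = m at hnm hm hmin
  have hm_ne : m ≠ n := by
    rintro rfl
    simp only [dist_self] at hm
    linarith
  have hm_ne' : m ≠ n + 1 := by
    rintro rfl
    linarith [hn n le_rfl]
  obtain ⟨k, rfl⟩ : ∃ k, m = k + 1 := ⟨m - 1, by omega⟩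
  have hk : dist (u k) (u n) < ε := by
    by_contra! h
    exact hmin k (by omega) ⟨by omega, h⟩
  have h₁ := hn n le_rfl
  have h₂ : dist (u (n + 2)) (u (n + 1)) < η := hn (n + 1) (by omega)
  have h₃ := hn k (by omega)
  have h₄ : dist (u (k + 2)) (u (k + 1)) < η := hn (k + 1) (by omega)
  have hle := hu n (k + 1) (by omega)
  rw [show k + 1 + 1 = k + 2 from rfl] at hle
  have hupper : dist (u (k + 1)) (u n) < ε + η := by
    linarith [dist_triangle (u (k + 1)) (u k) (u n)]
  have hupper' : dist (u (n + 1)) (u (k + 1)) < ε + 2 * η := by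
    linarith [dist_triangle (u (n + 1)) (u n) (u (k + 1)), dist_comm (u n) (u (k + 1))]
  have hlower : ε - 2 * η < dist (u (n + 1)) (u (k + 2)) := by
    have := dist_triangle4 (u (k + 1)) (u (k + 2)) (u (n + 1)) (u n)
    rw [dist_comm (u (k + 1)) (u (k + 2)), dist_comm (u (k + 2)) (u (n + 1))] at this
    linarith
  have hlower' : ε - 3 * η < dist (u (n + 2)) (u (k + 2)) := by
    have := dist_triangle (u (n + 1)) (u (n + 2)) (u (k + 2))
    rw [dist_comm (u (n + 1)) (u (n + 2))] at this
    linarith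
  have hφ : (φ (max (nndist (u n) (u (n + 1)))
      (max (nndist (u (n + 1)) (u (k + 1))) (nndist (u (k + 1)) (u n)))) : ℝ) < ε := by
    refine NNReal.coe_lt_coe.2 (hφδ ?_)
    rw [NNReal.dist_eq, abs_lt]
    push_cast
    refine ⟨?_, ?_⟩
    · linarith [(le_max_right _ _).trans (le_max_right (dist (u n) (u (n + 1)))
        (max (dist (u (n + 1)) (u (k + 1))) (dist (u (k + 1)) (u n))))]
    · rw [sub_lt_iff_lt_add]
      refine max_lt ?_ (max_lt ?_ ?_)
      · rw [dist_comm]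
        linarith
      · linarith
      · linarith
  have hF : (F (nndist (u n) (u (n + 1)), nndist (u (n + 1)) (u (n + 2)),
      nndist (u (k + 1)) (u (k + 2))) : ℝ) < ε / 4 := by
    have hnear := @hFγ (nndist (u n) (u (n + 1)), nndist (u (n + 1)) (u (n + 2)),
      nndist (u (k + 1)) (u (k + 2))) (by
        simp only [Prod.dist_eq, NNReal.dist_eq, coe_nndist, NNReal.coe_zero, sub_zero, abs_dist]
        rw [dist_comm] at h₁ h₂ h₄
        exact max_lt (h₁.trans_le hηγ) (max_lt (h₂.trans_le hηγ) (h₄.trans_le hηγ)))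
    rw [hF0, NNReal.dist_eq, NNReal.coe_zero, sub_zero] at hnear
    exact (le_abs_self _).trans_lt hnear
  linarith [dist_nonneg (x := u (n + 1)) (y := u (n + 2))]

/-- A continuous, asymptotically regular generalized (φ-F)-Ćirić–Reich–Rus type
mapping on a complete metric space with at least 3 points has a fixed point,
and at most two fixed points. -/
theorem generalized_phi_F_crr_fixed_point
    {X : Type*} [MetricSpace X] [CompleteSpace X]
    (h3 : ∃ p q r : X, p ≠ q ∧ p ≠ r ∧ q ≠ r)
    (T : X → X) (hcont : Continuous T)
    (har : ∀ x : X,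
      Tendsto (fun n : ℕ => dist (T^[n + 1] x) (T^[n] x)) atTop (𝓝 0))
    (φ : ℝ≥0 → ℝ≥0)
    (hφusc : UpperSemicontinuous φ)
    (hφlt : ∀ t : ℝ≥0, 0 < t → φ t < t)
    (F : ℝ≥0 × ℝ≥0 × ℝ≥0 → ℝ≥0)
    (hF0 : F (0, 0, 0) = 0)
    (hFcont : ContinuousAt F (0, 0, 0))
    (hT : ∀ x y z : X, x ≠ y → y ≠ z → x ≠ z →
      dist (T x) (T y) + dist (T y) (T z) + dist (T x) (T z) ≤
        (φ (max (nndist x y) (max (nndist y z) (nndist z x))) : ℝ) +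
        (F (nndist x (T x), nndist y (T y), nndist z (T z)) : ℝ)) :
    (∃ x : X, T x = x) ∧
    (∀ x y z : X, T x = x → T y = y → T z = z → x = y ∨ y = z ∨ x = z) := by
  refine ⟨?_, fun x y z hx hy hz => ?_⟩
  · by_contra! hfix
    obtain ⟨p, -⟩ := h3
    have hinj := iterate_injective_of_asymptotically_regular har hfix p
    have hcauchy : CauchySeq fun n : ℕ => T^[n] p := by
      refine cauchySeq_of_three_point_contraction_s14 (har p) hφusc hφlt hF0 hFcont
        fun n m hnm => ?_
      have hle := hT (T^[n] p) (T^[n + 1] p) (T^[m] p) (hinj.ne (by omega))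
        (hinj.ne (by omega)) (hinj.ne (by omega))
      simpa only [← Function.iterate_succ_apply'] using hle
    obtain ⟨a, ha⟩ := cauchySeq_tendsto_of_complete hcauchy
    exact hfix a (isFixedPt_of_tendsto_iterate ha hcont.continuousAt)
  · by_contra! hne
    obtain ⟨hxy, hyz, hxz⟩ := hne
    have hle := hT x y z hxy hyz hxz
    simp only [hx, hy, hz, nndist_self, hF0, NNReal.coe_zero, add_zero] at hle
    have hlt := NNReal.coe_lt_coe.2 (hφlt (max (nndist x y) (max (nndist y z) (nndist z x)))
      (lt_max_of_lt_left (NNReal.coe_pos.1 (by simpa using hxy))))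
    have hmax : max (dist x y) (max (dist y z) (dist z x)) ≤
        dist x y + dist y z + dist x z := by
      rw [dist_comm z x]
      have h₁ := dist_nonneg (x := x) (y := y)
      have h₂ := dist_nonneg (x := y) (y := z)
      have h₃ := dist_nonneg (x := x) (y := z)
      exact max_le (by linarith) (max_le (by linarith) (by linarith))
    push_cast at hlt
    linarith
end

section
/- Let (X,d) be a metric space with at least 3 points (not assumed complete), and let T : X → X be a generalized Ćirić–Reich–Rus type mapping with coefficients α, λ ≥ 0 satisfying 2α + (3/2)λ < 1, having no periodic points of prime period 2. Suppose T is continuous at a point x* ∈ X, and there exists x₀ ∈ X such that the iteration sequence x_n = T x_{n−1} (n = 1, 2, …) has a subsequence (x_{n_k}) converging to x*. Then x* is a fixed point of T, and the number of fixed points of T is at most two. -/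
open Filter Topology

/-- Consecutive points of an orbit that never meets a fixed point become arbitrarily close. -/
theorem tendsto_dist_iterate_succ_of_generalized_crr
    {X : Type*} [MetricSpace X] {T : X → X} {α lam : ℝ} (hα : 0 ≤ α) (hlam : 0 ≤ lam)
    (hsum : 2 * α + (3 / 2) * lam < 1)
    (hT : ∀ x y z : X, x ≠ y → y ≠ z → x ≠ z →
      dist (T x) (T y) + dist (T y) (T z) + dist (T x) (T z) ≤
        α * (dist x y + dist y z + dist z x) +
        lam * (dist x (T x) + dist y (T y) + dist z (T z)))
    (hper : ∀ x : X, T x ≠ x → T (T x) ≠ x) {x₀ : X}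
    (hfix : ∀ n, T (T^[n] x₀) ≠ T^[n] x₀) :
    Tendsto (fun n => dist (T^[n] x₀) (T (T^[n] x₀))) atTop (𝓝 0) := by
  let perimeter : X → ℝ := fun x => dist x (T x) + dist (T x) (T (T x)) + dist x (T (T x))
  set c : ℝ := (α + lam) / (1 - lam / 2) with hc
  have hden : 0 < 1 - lam / 2 := by linarith
  have hc0 : 0 ≤ c := by positivity
  have hc1 : c < 1 := by rw [hc, div_lt_one hden]; linarith
  have hstep : ∀ n, perimeter (T^[n + 1] x₀) ≤ c * perimeter (T^[n] x₀) := by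
    intro n
    have hn := hfix n
    have hn' := hfix (n + 1)
    rw [Function.iterate_succ_apply'] at hn' ⊢
    generalize T^[n] x₀ = x at hn hn' ⊢
    have h := hT x (T x) (T (T x)) hn.symm hn'.symm (hper x hn).symm
    rw [hc, div_mul_eq_mul_div, le_div_iff₀ hden]
    simp only [perimeter]
    rw [dist_comm (T (T x)) x] at h
    have htri := dist_triangle_left (T (T x)) (T (T (T x))) (T x)
    have h₁ := mul_le_mul_of_nonneg_left htri hlam
    have h₂ := mul_nonneg hlam (dist_nonneg (x := x) (y := T (T x)))
    linarith
  have hbound : ∀ n, perimeter (T^[n] x₀) ≤ c ^ n * perimeter x₀ := fun n =>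
    le_geom (u := fun n => perimeter (T^[n] x₀)) hc0 n fun k _ => hstep k
  refine squeeze_zero (fun _ => dist_nonneg) (fun n => le_trans ?_ (hbound n)) ?_
  · simp only [perimeter, add_assoc]
    exact le_add_of_nonneg_right (by positivity)
  · simpa using (tendsto_pow_atTop_nhds_zero_of_lt_one hc0 hc1).mul_const (perimeter x₀)

/-- In a metric space (not necessarily complete), a generalized
Ćirić–Reich–Rus type mapping without periodic points of prime period 2 which
is continuous at x*, such that some iteration sequence has a subsequence
converging to x*, has x* as a fixed point; moreover it has at most two fixed
points. -/
theorem generalized_crr_fixed_point_incomplete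
    {X : Type*} [MetricSpace X]
    (h3 : ∃ p q r : X, p ≠ q ∧ p ≠ r ∧ q ≠ r)
    (T : X → X) (α lam : ℝ) (hα : 0 ≤ α) (hlam : 0 ≤ lam)
    (hsum : 2 * α + (3 / 2) * lam < 1)
    (hT : ∀ x y z : X, x ≠ y → y ≠ z → x ≠ z →
      dist (T x) (T y) + dist (T y) (T z) + dist (T x) (T z) ≤
        α * (dist x y + dist y z + dist z x) +
        lam * (dist x (T x) + dist y (T y) + dist z (T z)))
    (hper : ∀ x : X, T x ≠ x → T (T x) ≠ x)
    (xstar : X) (hcont : ContinuousAt T xstar)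
    (x₀ : X)
    (hsub : ∃ φ : ℕ → ℕ, StrictMono φ ∧
      Tendsto (fun k : ℕ => T^[φ k] x₀) atTop (𝓝 xstar)) :
    T xstar = xstar ∧
    (∀ x y z : X, T x = x → T y = y → T z = z → x = y ∨ y = z ∨ x = z) := by
  refine ⟨?_, fun x y z hx hy hz => ?_⟩
  · obtain ⟨φ, hφ, hlim⟩ := hsub
    by_cases hfix : ∀ n, T (T^[n] x₀) ≠ T^[n] x₀
    · have hdist := (tendsto_dist_iterate_succ_of_generalized_crr hα hlam hsum hT hper hfix).comp
        hφ.tendsto_atTop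
      have hzero := tendsto_nhds_unique (hlim.dist (hcont.tendsto.comp hlim)) hdist
      exact (dist_eq_zero.mp hzero).symm
    · push Not at hfix
      obtain ⟨n, hn⟩ := hfix
      have hconst : ∀ᶠ k in atTop, T^[n] x₀ = T^[φ k] x₀ := by
        filter_upwards [hφ.tendsto_atTop.eventually_ge_atTop n] with k hk
        rw [← Nat.sub_add_cancel hk, Function.iterate_add_apply]
        exact (Function.iterate_fixed hn _).symm
      have heq : xstar = T^[n] x₀ :=
        tendsto_nhds_unique hlim (tendsto_const_nhds.congr' hconst)
      rw [heq, hn]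
  · by_contra! hne
    have h := hT x y z hne.1 hne.2.1 hne.2.2
    simp only [hx, hy, hz, dist_self] at h
    rw [dist_comm z x] at h
    have hpos : 0 < dist x y := dist_pos.mpr hne.1
    have hperim : 0 < dist x y + dist y z + dist x z := by positivity
    nlinarith
end

section
/- Let (X,d) be a metric space with at least 3 points, let M ⊆ X be an everywhere dense subset of X, and let T : X → X be continuous on X. Suppose there exist α, λ ≥ 0 with 2α + (3/2)λ < 1 such that d(Tx,Ty) + d(Ty,Tz) + d(Tx,Tz) ≤ α(d(x,y) + d(y,z) + d(z,x)) + λ(d(x,Tx) + d(y,Ty) + d(z,Tz)) holds for all pairwise distinct x, y, z ∈ M. Then this same inequality holds for all pairwise distinct x, y, z ∈ X; i.e., T is a generalized Ćirić–Reich–Rus type mapping on all of X with the same coefficients α, λ. -/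
/-- If a continuous mapping T satisfies the generalized Ćirić–Reich–Rus
inequality on an everywhere dense subset M of X, then it satisfies it on all
of X with the same coefficients. -/
theorem generalized_crr_dense_extension
    {X : Type*} [MetricSpace X]
    (h3 : ∃ p q r : X, p ≠ q ∧ p ≠ r ∧ q ≠ r)
    (M : Set X) (hM : Dense M)
    (T : X → X) (hcont : Continuous T)
    (α lam : ℝ) (hα : 0 ≤ α) (hlam : 0 ≤ lam)
    (hsum : 2 * α + (3 / 2) * lam < 1)
    (hT : ∀ x ∈ M, ∀ y ∈ M, ∀ z ∈ M, x ≠ y → y ≠ z → x ≠ z →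
      dist (T x) (T y) + dist (T y) (T z) + dist (T x) (T z) ≤
        α * (dist x y + dist y z + dist z x) +
        lam * (dist x (T x) + dist y (T y) + dist z (T z))) :
    ∀ x y z : X, x ≠ y → y ≠ z → x ≠ z →
      dist (T x) (T y) + dist (T y) (T z) + dist (T x) (T z) ≤
        α * (dist x y + dist y z + dist z x) +
        lam * (dist x (T x) + dist y (T y) + dist z (T z)) := by
  intro x y z hxy hyz hxz
  by_contra! hlt
  -- The distinct triples violating the inequality form an open set, so it meets `M × M × M`.
  let U : Set (X × X × X) := {p | (p.1 ≠ p.2.1 ∧ p.2.1 ≠ p.2.2 ∧ p.1 ≠ p.2.2) ∧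
    α * (dist p.1 p.2.1 + dist p.2.1 p.2.2 + dist p.2.2 p.1) +
        lam * (dist p.1 (T p.1) + dist p.2.1 (T p.2.1) + dist p.2.2 (T p.2.2)) <
      dist (T p.1) (T p.2.1) + dist (T p.2.1) (T p.2.2) + dist (T p.1) (T p.2.2)}
  have hU : IsOpen U := by
    refine IsOpen.and (IsOpen.and ?_ (IsOpen.and ?_ ?_)) (isOpen_lt ?_ ?_)
    · exact isOpen_ne_fun continuous_fst continuous_snd.fst
    · exact isOpen_ne_fun continuous_snd.fst continuous_snd.snd
    · exact isOpen_ne_fun continuous_fst continuous_snd.snd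
    · fun_prop
    · fun_prop
  obtain ⟨⟨a, b, c⟩, ⟨⟨hab, hbc, hac⟩, habc⟩, ha, hb, hc⟩ :=
    (hM.prod (hM.prod hM)).inter_open_nonempty U hU ⟨(x, y, z), ⟨hxy, hyz, hxz⟩, hlt⟩
  exact absurd (hT a ha b hb c hc hab hbc hac) habc.not_ge
end

section
/- Let (X,d) be a metric space with at least 3 points (not assumed complete), and let T : X → X be continuous on X and have no periodic points of prime period 2. Suppose there exist an everywhere dense subset M of X and constants α, λ ≥ 0 with 2α + (3/2)λ < 1 such that d(Tx,Ty) + d(Ty,Tz) + d(Tx,Tz) ≤ α(d(x,y) + d(y,z) + d(z,x)) + λ(d(x,Tx) + d(y,Ty) + d(z,Tz)) holds for all pairwise distinct x, y, z ∈ M. Suppose further that there exists x₀ ∈ X such that the iteration sequence x_n = T x_{n−1} (n = 1, 2, …) has a subsequence (x_{n_k}) converging to a point x* ∈ X. Then x* is a fixed point of T, and the number of fixed points of T is at most two. -/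
open Filter Topology

/-- A closed relation on triples that holds for pairwise distinct points of a dense set holds for
all pairwise distinct points. -/
theorem Dense.forall_pairwise_distinct_triple {X : Type*} [TopologicalSpace X] [T2Space X]
    {M : Set X} (hM : Dense M) {C : Set (X × X × X)} (hC : IsClosed C)
    (h : ∀ x ∈ M, ∀ y ∈ M, ∀ z ∈ M, x ≠ y → y ≠ z → x ≠ z → (x, y, z) ∈ C)
    {x y z : X} (hxy : x ≠ y) (hyz : y ≠ z) (hxz : x ≠ z) : (x, y, z) ∈ C := by
  let U : Set (X × X × X) := {p | p.1 ≠ p.2.1 ∧ p.2.1 ≠ p.2.2 ∧ p.1 ≠ p.2.2}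
  have hU : IsOpen U :=
    (isOpen_ne_fun (by fun_prop) (by fun_prop)).inter
      ((isOpen_ne_fun (by fun_prop) (by fun_prop)).inter
        (isOpen_ne_fun (by fun_prop) (by fun_prop)))
  have hsub : U ∩ M ×ˢ M ×ˢ M ⊆ C := by
    rintro ⟨a, b, c⟩ ⟨⟨hab, hbc, hac⟩, ha, hb, hc⟩
    exact h a ha b hb c hc hab hbc hac
  exact closure_minimal hsub hC
    ((hM.prod (hM.prod hM)).open_subset_closure_inter hU ⟨hxy, hyz, hxz⟩)

/-- If `T` has no points of prime period two and satisfies the three-point inequality, the perimeter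
of the triangle `x, T x, T (T x)` contracts under `T`. -/
theorem orbit_perimeter_le {X : Type*} [MetricSpace X] {T : X → X}
    (hper : ∀ x : X, T x ≠ x → T (T x) ≠ x) {α lam : ℝ} (hα : 0 ≤ α) (hlam : 0 ≤ lam)
    (hlam_lt : lam < 1)
    (hT : ∀ x y z : X, x ≠ y → y ≠ z → x ≠ z →
      dist (T x) (T y) + dist (T y) (T z) + dist (T x) (T z) ≤
        α * (dist x y + dist y z + dist z x) +
        lam * (dist x (T x) + dist y (T y) + dist z (T z))) (x : X) :
    dist (T x) (T (T x)) + dist (T (T x)) (T (T (T x))) + dist (T x) (T (T (T x))) ≤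
      (α + lam / 2) / (1 - lam) *
        (dist x (T x) + dist (T x) (T (T x)) + dist x (T (T x))) := by
  have hpos : 0 < 1 - lam := by linarith
  by_cases h : T (T x) = T x
  · simp only [h, dist_self]
    have : 0 ≤ (α + lam / 2) / (1 - lam) := by positivity
    simp only [add_zero]
    positivity
  have h' : T x ≠ x := fun e => h (by rw [e, e])
  have key := hT x (T x) (T (T x)) h'.symm (Ne.symm h) (hper x h').symm
  rw [dist_comm (T (T x)) x] at key
  have htri : dist x (T x) ≤ dist x (T (T x)) + dist (T x) (T (T x)) := by
    simpa only [dist_comm (T x)] using dist_triangle x (T (T x)) (T x)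
  have hnonneg : 0 ≤ dist (T x) (T (T (T x))) := dist_nonneg
  rw [div_mul_eq_mul_div, le_div_iff₀ hpos]
  nlinarith [mul_le_mul_of_nonneg_left htri hlam, mul_nonneg hlam hnonneg]

/-- In a metric space (not necessarily complete), if T is continuous, has no
periodic points of prime period 2, satisfies the generalized Ćirić–Reich–Rus
inequality on an everywhere dense subset M, and some iteration sequence has a
subsequence converging to x*, then x* is a fixed point of T, and T has at most
two fixed points. -/
theorem generalized_crr_dense_fixed_point
    {X : Type*} [MetricSpace X]
    (h3 : ∃ p q r : X, p ≠ q ∧ p ≠ r ∧ q ≠ r)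
    (T : X → X) (hcont : Continuous T)
    (hper : ∀ x : X, T x ≠ x → T (T x) ≠ x)
    (M : Set X) (hM : Dense M)
    (α lam : ℝ) (hα : 0 ≤ α) (hlam : 0 ≤ lam)
    (hsum : 2 * α + (3 / 2) * lam < 1)
    (hT : ∀ x ∈ M, ∀ y ∈ M, ∀ z ∈ M, x ≠ y → y ≠ z → x ≠ z →
      dist (T x) (T y) + dist (T y) (T z) + dist (T x) (T z) ≤
        α * (dist x y + dist y z + dist z x) +
        lam * (dist x (T x) + dist y (T y) + dist z (T z)))
    (x₀ : X) (xstar : X)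
    (hsub : ∃ φ : ℕ → ℕ, StrictMono φ ∧
      Tendsto (fun k : ℕ => T^[φ k] x₀) atTop (𝓝 xstar)) :
    T xstar = xstar ∧
    (∀ x y z : X, T x = x → T y = y → T z = z → x = y ∨ y = z ∨ x = z) := by
  replace hT : ∀ x y z : X, x ≠ y → y ≠ z → x ≠ z →
      dist (T x) (T y) + dist (T y) (T z) + dist (T x) (T z) ≤
        α * (dist x y + dist y z + dist z x) +
        lam * (dist x (T x) + dist y (T y) + dist z (T z)) := by
    intro x y z hxy hyz hxz
    exact hM.forall_pairwise_distinct_triple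
      (C := {p | dist (T p.1) (T p.2.1) + dist (T p.2.1) (T p.2.2) + dist (T p.1) (T p.2.2) ≤
        α * (dist p.1 p.2.1 + dist p.2.1 p.2.2 + dist p.2.2 p.1) +
        lam * (dist p.1 (T p.1) + dist p.2.1 (T p.2.1) + dist p.2.2 (T p.2.2))})
      (isClosed_le (by fun_prop) (by fun_prop)) hT hxy hyz hxz
  refine ⟨?_, fun x y z hx hy hz => ?_⟩
  · obtain ⟨φ, hφ, hlim⟩ := hsub
    have hpos : 0 < 1 - lam := by linarith
    set q := (α + lam / 2) / (1 - lam) with hq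
    have hq0 : 0 ≤ q := by positivity
    have hq1 : q < 1 := by
      rw [hq, div_lt_one hpos]
      linarith
    let P : X → ℝ := fun x => dist x (T x) + dist (T x) (T (T x)) + dist x (T (T x))
    have hP : ∀ n, P (T^[n] x₀) ≤ q ^ n * P x₀ := by
      intro n
      induction n with
      | zero => simp
      | succ n ih =>
        rw [Function.iterate_succ_apply', pow_succ', mul_assoc]
        exact (orbit_perimeter_le hper hα hlam (by linarith) hT _).trans
          (mul_le_mul_of_nonneg_left ih hq0)
    have hstep : Tendsto (fun n => dist (T^[n] x₀) (T (T^[n] x₀))) atTop (𝓝 0) := by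
      refine squeeze_zero (fun _ => dist_nonneg) (fun n => le_trans ?_ (hP n))
        (by simpa using (tendsto_pow_atTop_nhds_zero_of_lt_one hq0 hq1).mul_const (P x₀))
      simp only [P, add_assoc]
      exact le_add_of_nonneg_right (by positivity)
    have hdist := hlim.dist ((hcont.tendsto xstar).comp hlim)
    exact (dist_eq_zero.mp
      (tendsto_nhds_unique hdist (hstep.comp hφ.tendsto_atTop))).symm
  · by_contra! hne
    obtain ⟨hxy, hyz, hxz⟩ := hne
    have key := hT x y z hxy hyz hxz
    simp only [hx, hy, hz, dist_self, add_zero, mul_zero, dist_comm z x] at key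
    have hsum_pos : 0 < dist x y + dist y z + dist x z := by
      have := dist_pos.mpr hxy
      positivity
    nlinarith
end
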